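/- Every finite simple planar graph is 5-choosable: if G is a finite simple planar graph and L is a list assignment with |L(v)| ≥ 5 for every vertex v, then G admits an L-colouring. -/

import Mathlib

/-- `H` is a minor of `G`: there is a family of nonempty, pairwise disjoint, connected
branch sets in `G` indexed by the vertices of `H`, with an edge of `G` between the
branch sets of any two adjacent vertices of `H`. -/
def SimpleGraph.IsMinorOf {W V : Type*} (H : SimpleGraph W) (G : SimpleGraph V) : Prop :=
  ∃ f : W → Set V,
    (∀ w, (G.induce (f w)).Connected) ∧
    (Pairwise fun w₁ w₂ => Disjoint (f w₁) (f w₂)) ∧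
    ∀ ⦃w₁ w₂⦄, H.Adj w₁ w₂ → ∃ v₁ ∈ f w₁, ∃ v₂ ∈ f w₂, G.Adj v₁ v₂

/-- A graph is planar iff (by Wagner's theorem) it has neither `K₅` nor `K₃,₃` as a minor. -/
def SimpleGraph.IsPlanar {V : Type*} (G : SimpleGraph V) : Prop :=
  ¬ (completeGraph (Fin 5)).IsMinorOf G ∧
  ¬ (completeBipartiteGraph (Fin 3) (Fin 3)).IsMinorOf G


namespace SimpleGraph

variable {V : Type*} {G : SimpleGraph V}

/-- Some edge of `G` joins a vertex of `s` to a vertex of `t`. -/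
def Touches (G : SimpleGraph V) (s t : Set V) : Prop :=
  ∃ a ∈ s, ∃ b ∈ t, G.Adj a b

lemma Touches.symm {s t : Set V} (h : G.Touches s t) : G.Touches t s := by
  obtain ⟨a, ha, b, hb, hab⟩ := h
  exact ⟨b, hb, a, ha, hab.symm⟩

lemma Touches.mono {s t s' t' : Set V} (h : G.Touches s t) (hs : s ⊆ s') (ht : t ⊆ t') :
    G.Touches s' t' := by
  obtain ⟨a, ha, b, hb, hab⟩ := h
  exact ⟨a, hs ha, b, ht hb, hab⟩

lemma induce_singleton_connected (G : SimpleGraph V) (v : V) : (G.induce {v}).Connected :=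
  ⟨Preconnected.of_subsingleton⟩

lemma Touches.induce_union_connected {s t : Set V} (h : G.Touches s t)
    (hs : (G.induce s).Connected) (ht : (G.induce t).Connected) :
    (G.induce (s ∪ t)).Connected := by
  obtain ⟨a, ha, b, hb, hab⟩ := h
  exact connected_induce_union hs.preconnected ht.preconnected ha hb hab

lemma induce_insert_connected {s : Set V} {u w : V} (hs : (G.induce s).Connected)
    (hu : u ∈ s) (huw : G.Adj u w) : (G.induce (insert w s)).Connected := by
  rw [← Set.union_singleton]
  exact Touches.induce_union_connected ⟨u, hu, w, rfl, huw⟩ hs (induce_singleton_connected G w)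

/-- The connected component of `a` in the subgraph induced on `W`. -/
lemma exists_connected_closed [Finite V] (G : SimpleGraph V) {W : Set V} {a : V} (ha : a ∈ W) :
    ∃ C ⊆ W, a ∈ C ∧ (G.induce C).Connected ∧
      ∀ u ∈ C, ∀ w ∈ W, G.Adj u w → w ∈ C := by
  obtain ⟨C, haC, ⟨hCW, hC⟩, hmax⟩ := Finite.exists_le_maximal
    (p := fun C : Set V => C ⊆ W ∧ (G.induce C).Connected) (a := {a})
    ⟨Set.singleton_subset_iff.2 ha, induce_singleton_connected G a⟩
  refine ⟨C, hCW, haC rfl, hC, fun u hu w hw huw => ?_⟩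
  exact hmax ⟨Set.insert_subset hw hCW, induce_insert_connected hC hu huw⟩
    (Set.subset_insert w C) (Set.mem_insert w C)

/-- Two disjoint sets meeting a connected set `W` are joined inside `W`, either by an edge or
through a connected set avoiding both. -/
lemma exists_link {W P Q : Set V} (hW : (G.induce W).Connected)
    (hPW : (W ∩ P).Nonempty) (hQW : (W ∩ Q).Nonempty) (hPQ : Disjoint P Q) :
    G.Touches P Q ∨ ∃ C ⊆ W, Disjoint C P ∧ Disjoint C Q ∧ (G.induce C).Connected ∧
      G.Touches C P ∧ G.Touches C Q := by
  obtain ⟨p, hpW, hp⟩ := hPW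
  obtain ⟨q, hqW, hq⟩ := hQW
  by_contra! hcon
  obtain ⟨hnt, hno⟩ := hcon
  obtain ⟨walk⟩ := hW.preconnected ⟨p, hpW⟩ ⟨q, hqW⟩
  have key : ∀ (a b : W) (_ : (G.induce W).Walk a b), b.1 ∈ Q →
      a.1 ∈ Q ∨ (a.1 ∉ P ∧ ∃ C ⊆ W, a.1 ∈ C ∧ Disjoint C P ∧ Disjoint C Q ∧
        (G.induce C).Connected ∧ G.Touches C Q) := by
    intro a b w
    induction w with
    | nil => exact Or.inl
    | @cons a b c hab _ ih =>
      intro hc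
      have hab' : G.Adj a.1 b.1 := hab
      by_cases haQ : a.1 ∈ Q
      · exact Or.inl haQ
      refine Or.inr ?_
      rcases ih hc with hbQ | ⟨hbP, C, hCW, hbC, hCP, hCQ, hC, hCt⟩
      · have haP : a.1 ∉ P := fun haP => hnt ⟨_, haP, _, hbQ, hab'⟩
        exact ⟨haP, {a.1}, by simp, rfl, by simpa, by simpa, induce_singleton_connected G _,
          _, rfl, _, hbQ, hab'⟩
      · have haP : a.1 ∉ P := fun haP =>
          hno C hCW hCP hCQ hC ⟨_, hbC, _, haP, hab'.symm⟩ hCt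
        exact ⟨haP, insert a.1 C, Set.insert_subset a.2 hCW, Set.mem_insert _ _,
          Set.disjoint_insert_left.2 ⟨haP, hCP⟩, Set.disjoint_insert_left.2 ⟨haQ, hCQ⟩,
          induce_insert_connected hC hbC hab'.symm,
          hCt.mono (Set.subset_insert _ _) subset_rfl⟩
  rcases key _ _ walk hq with h | h
  · exact Set.disjoint_left.1 hPQ hp h
  · exact h.1 hp

lemma exists_link_union {W P Q : Set V} (hW : (G.induce W).Connected)
    (hPW : (W ∩ P).Nonempty) (hQW : (W ∩ Q).Nonempty) (hPQ : Disjoint P Q)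
    (hP : (G.induce P).Connected) :
    ∃ C ⊆ W, Disjoint C P ∧ Disjoint C Q ∧ (G.induce (P ∪ C)).Connected ∧
      G.Touches (P ∪ C) Q ∧
      (C.Nonempty → (G.induce C).Connected ∧ G.Touches C P ∧ G.Touches C Q) := by
  rcases exists_link hW hPW hQW hPQ with h | ⟨C, hCW, hCP, hCQ, hC, htP, htQ⟩
  · exact ⟨∅, by simp, by simp, by simp, by rwa [Set.union_empty], by simpa using h, by simp⟩
  · exact ⟨C, hCW, hCP, hCQ, htP.symm.induce_union_connected hP hC,
      htQ.mono Set.subset_union_right subset_rfl, fun _ => ⟨hC, htP, htQ⟩⟩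

lemma isMinorOf_completeGraph_five {A B : Set V} {U : Fin 3 → Set V}
    (hA : (G.induce A).Connected) (hB : (G.induce B).Connected)
    (hU : ∀ i, (G.induce (U i)).Connected) (hAB : Disjoint A B)
    (hAU : ∀ i, Disjoint A (U i)) (hBU : ∀ i, Disjoint B (U i))
    (hUU : Pairwise fun i j => Disjoint (U i) (U j))
    (tAB : G.Touches A B) (tAU : ∀ i, G.Touches A (U i)) (tBU : ∀ i, G.Touches B (U i))
    (tUU : ∀ i, G.Touches (U i) (U (i + 1))) :
    (completeGraph (Fin 5)).IsMinorOf G := by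
  have tUU' : ∀ i j, i ≠ j → G.Touches (U i) (U j) := by
    intro i j hij
    obtain rfl | rfl : j = i + 1 ∨ i = j + 1 := by revert i j; decide
    · exact tUU i
    · exact (tUU j).symm
  refine ⟨Fin.cons A (Fin.cons B U), ?_, ?_, ?_⟩
  · intro w
    refine Fin.cases hA (fun w => ?_) w
    exact Fin.cases hB hU w
  · intro i j
    refine Fin.cases ?_ (fun i => ?_) i <;> refine Fin.cases ?_ (fun j => ?_) j
    · simp
    · exact fun _ => Fin.cases hAB hAU j
    · exact fun _ => Fin.cases hAB.symm (fun i => (hAU i).symm) i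
    · refine Fin.cases ?_ (fun i => ?_) i <;> refine Fin.cases ?_ (fun j => ?_) j
      · simp
      · exact fun _ => hBU j
      · exact fun _ => (hBU i).symm
      · exact fun h => hUU (by simpa using h)
  · intro i j
    change _ → G.Touches _ _
    rw [top_adj]
    refine Fin.cases ?_ (fun i => ?_) i <;> refine Fin.cases ?_ (fun j => ?_) j
    · simp
    · exact fun _ => Fin.cases tAB tAU j
    · exact fun _ => Fin.cases tAB.symm (fun i => (tAU i).symm) i
    · refine Fin.cases ?_ (fun i => ?_) i <;> refine Fin.cases ?_ (fun j => ?_) j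
      · simp
      · exact fun _ => tBU j
      · exact fun _ => (tBU i).symm
      · exact fun h => tUU' i j (by simpa using h)

lemma isMinorOf_completeBipartiteGraph {m n : ℕ} {T : Fin m → Set V} {U : Fin n → Set V}
    (hT : ∀ i, (G.induce (T i)).Connected) (hU : ∀ i, (G.induce (U i)).Connected)
    (hTT : Pairwise fun i j => Disjoint (T i) (T j))
    (hUU : Pairwise fun i j => Disjoint (U i) (U j))
    (hTU : ∀ i j, Disjoint (T i) (U j)) (t : ∀ i j, G.Touches (T i) (U j)) :
    (completeBipartiteGraph (Fin m) (Fin n)).IsMinorOf G := by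
  refine ⟨Sum.elim T U, by rintro (i | i) <;> simp [hT, hU], ?_, ?_⟩
  · rintro (i | i) (j | j) h
    · exact hTT (by simpa using h)
    · exact hTU i j
    · exact (hTU j i).symm
    · exact hUU (by simpa using h)
  · rintro (i | i) (j | j) h
    · simp at h
    · exact t i j
    · exact (t j i).symm
    · simp at h

/-- In a planar graph, let `A` and `B` be adjacent branch sets that both touch three further
branch sets `U i`. Then, off `A ∪ B`, some `U i` separates the other two. -/
lemma IsPlanar.false_of_linked (hG : G.IsPlanar) {A B : Set V} {U W : Fin 3 → Set V}
    (hA : (G.induce A).Connected) (hB : (G.induce B).Connected)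
    (hU : ∀ i, (G.induce (U i)).Connected) (hAB : Disjoint A B)
    (hAU : ∀ i, Disjoint A (U i)) (hBU : ∀ i, Disjoint B (U i))
    (hUU : Pairwise fun i j => Disjoint (U i) (U j))
    (tAB : G.Touches A B) (tAU : ∀ i, G.Touches A (U i)) (tBU : ∀ i, G.Touches B (U i))
    (hW : ∀ i, (G.induce (W i)).Connected)
    (hAW : ∀ i, Disjoint A (W i)) (hBW : ∀ i, Disjoint B (W i))
    (hWU : ∀ i, Disjoint (W i) (U i))
    (hmeet : ∀ i j, i ≠ j → (W i ∩ U j).Nonempty) : False := by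
  have e1 : ∀ i : Fin 3, i ≠ i + 1 := by decide
  have e2 : ∀ i : Fin 3, i ≠ i + 2 := by decide
  have e3 : ∀ i : Fin 3, i + 1 ≠ i + 2 := by decide
  have e4 : ∀ i j : Fin 3, j = i ∨ j = i + 1 ∨ j = i + 2 := by decide
  have e5 : ∀ i : Fin 3, i + 2 + 1 = i := by decide
  have e6 : ∀ i : Fin 3, i + 2 + 2 = i + 1 := by decide
  choose C hCW hC1 hC2 hPC htPC hCne using fun i =>
    exists_link_union (hW i) (hmeet i (i + 1) (e1 i)) (hmeet i (i + 2) (e2 i))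
      (hUU (e3 i)) (hU (i + 1))
  have hCU : ∀ i j, Disjoint (C i) (U j) := by
    intro i j
    rcases e4 i j with rfl | rfl | rfl
    · exact (hWU _).mono_left (hCW _)
    · exact hC1 i
    · exact hC2 i
  have hAC : ∀ i, Disjoint A (C i) := fun i => (hAW i).mono_right (hCW i)
  have hBC : ∀ i, Disjoint B (C i) := fun i => (hBW i).mono_right (hCW i)
  by_cases hcc : Pairwise fun i j => Disjoint (C i) (C j)
  · refine hG.1 (isMinorOf_completeGraph_five (U := fun i => U i ∪ C (i + 2)) hA hB ?_ hAB ?_ ?_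
      ?_ tAB ?_ ?_ ?_)
    · intro i
      have := hPC (i + 2)
      rwa [e5] at this
    · exact fun i => (hAU i).union_right (hAC _)
    · exact fun i => (hBU i).union_right (hBC _)
    · intro i j hij
      refine Disjoint.union_left ((hUU hij).union_right (hCU _ _).symm)
        ((hCU _ _).union_right (hcc ?_))
      simpa using hij
    · exact fun i => (tAU i).mono subset_rfl Set.subset_union_left
    · exact fun i => (tBU i).mono subset_rfl Set.subset_union_left
    · intro i
      have := htPC (i + 2)
      rw [e5, e6] at this
      exact this.mono subset_rfl Set.subset_union_left
  · simp only [Pairwise, not_forall] at hcc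
    obtain ⟨i, j, hij, hd⟩ := hcc
    rw [Set.not_disjoint_iff_nonempty_inter] at hd
    have hi := hCne i (hd.mono Set.inter_subset_left)
    have hj := hCne j (hd.mono Set.inter_subset_right)
    refine hG.2 (isMinorOf_completeBipartiteGraph (T := ![A, B, C i ∪ C j]) (U := U)
      ?_ hU ?_ hUU ?_ ?_)
    · simp only [Fin.forall_fin_succ, Matrix.cons_val_zero]
      exact ⟨hA, hB, induce_union_connected hi.1.preconnected hj.1.preconnected hd, by simp⟩
    · have h1 : Disjoint A (C i ∪ C j) := (hAC i).union_right (hAC j)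
      have h2 : Disjoint B (C i ∪ C j) := (hBC i).union_right (hBC j)
      intro k l hkl
      fin_cases k <;> fin_cases l <;> first | exact absurd rfl hkl | skip
      exacts [hAB, h1, hAB.symm, h2, h1.symm, h2.symm]
    · simp only [Fin.forall_fin_succ (n := 2), Fin.forall_fin_succ (n := 1),
        Fin.forall_fin_succ (n := 0), Matrix.cons_val_zero, Matrix.cons_val_succ]
      simp [hAU, hBU, hCU]
    · have h : ∀ k, G.Touches (C i ∪ C j) (U k) := by
        intro k
        have hk : ∀ i, i ≠ k → ((C i).Nonempty → (G.induce (C i)).Connected ∧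
            G.Touches (C i) (U (i + 1)) ∧ G.Touches (C i) (U (i + 2))) → (C i).Nonempty →
            G.Touches (C i) (U k) := by
          intro i hik h hn
          rcases e4 i k with rfl | rfl | rfl
          exacts [absurd rfl hik, (h hn).2.1, (h hn).2.2]
        by_cases hik : i = k
        · subst hik
          exact (hk j hij.symm (hCne j) (hd.mono Set.inter_subset_right)).mono
            Set.subset_union_right subset_rfl
        · exact (hk i hik (hCne i) (hd.mono Set.inter_subset_left)).mono
            Set.subset_union_left subset_rfl
      intro k l
      fin_cases k
      exacts [tAU l, tBU l, h l]

/-- The vertices of `A` with a neighbour in `Z`. -/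
def boundary (G : SimpleGraph V) (Z A : Set V) : Set V :=
  {v | v ∈ A ∧ ∃ z ∈ Z, G.Adj z v}

/-- No edge of `G` with both ends in `S` separates the subgraph induced on `A`. -/
def NoSeparatingChord (G : SimpleGraph V) (S A : Set V) : Prop :=
  ∀ a ∈ S, ∀ b ∈ S, G.Adj a b → ∀ B ⊆ A \ {a, b}, B.Nonempty →
    (∀ u ∈ B, ∀ w ∈ A \ {a, b}, G.Adj u w → w ∈ B) → B = A \ {a, b}

lemma NoSeparatingChord.connected [Finite V] {S A : Set V} (h : G.NoSeparatingChord S A) {a b : V}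
    (ha : a ∈ S) (hb : b ∈ S) (hab : G.Adj a b) (hne : (A \ {a, b}).Nonempty) :
    (G.induce (A \ {a, b})).Connected := by
  obtain ⟨u, hu⟩ := hne
  obtain ⟨C, hCW, huC, hC, hcl⟩ := exists_connected_closed G hu
  rwa [← h a ha b hb hab C hCW ⟨u, huC⟩ hcl]

lemma degree_induce [Finite V] (G : SimpleGraph V) (C : Set V) (w : C)
    [Fintype ((G.induce C).neighborSet w)] :
    (G.induce C).degree w = (G.neighborSet w ∩ C).ncard := by
  rw [← card_neighborSet_eq_degree, ← Nat.card_eq_fintype_card, Nat.card_coe_set_eq,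
    ← Set.ncard_image_of_injective _ Subtype.val_injective]
  congr 1
  ext v
  simp

/-- In a graph whose vertices all have degree two, deleting `d` leaves its two neighbours in the
same component. -/
lemma mem_of_two_regular [Finite V] {T C : Set V} {d a b : V}
    (hT : ∀ t ∈ T, (G.neighborSet t ∩ T).ncard = 2) (hd : d ∈ T)
    (hN : G.neighborSet d ∩ T = {a, b}) (hCT : C ⊆ T \ {d}) (ha : a ∈ C)
    (hcl : ∀ u ∈ C, ∀ w ∈ T \ {d}, G.Adj u w → w ∈ C) : b ∈ C := by
  classical
  have := Fintype.ofFinite V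
  by_contra hb
  have hda : G.Adj d a := by
    have : a ∈ G.neighborSet d ∩ T := by simp [hN]
    exact this.1
  have hNC : ∀ w ∈ C, G.neighborSet w ∩ C = (G.neighborSet w ∩ T) \ {d} := by
    intro w hw
    ext v
    constructor
    · exact fun h => ⟨⟨h.1, (hCT h.2).1⟩, (hCT h.2).2⟩
    · exact fun h => ⟨h.1.1, hcl w hw v ⟨h.1.2, h.2⟩ h.1.1⟩
  obtain ⟨⟨w, hw⟩, hwa, hodd⟩ :=
    (G.induce C).exists_ne_odd_degree_of_exists_odd_degree ⟨a, ha⟩ (by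
      rw [degree_induce, hNC a ha,
        Set.ncard_sdiff_singleton_of_mem (show d ∈ G.neighborSet a ∩ T from ⟨hda.symm, hd⟩),
        hT a (hCT ha).1]
      decide)
  rw [degree_induce, hNC w hw, Set.sdiff_singleton_eq_self, hT w (hCT hw).1] at hodd
  · exact absurd hodd (by decide)
  · intro h
    have : w ∈ G.neighborSet d ∩ T := ⟨G.adj_symm h.1, (hCT hw).1⟩
    rw [hN] at this
    rcases this with rfl | rfl
    · exact hwa rfl
    · exact hb hw

section Boundary

variable [Finite V] {Z A : Set V}

lemma IsPlanar.ncard_neighborSet_boundary_le (hG : G.IsPlanar) (hZ : (G.induce Z).Connected)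
    (hZA : Disjoint Z A) (hS : G.NoSeparatingChord (G.boundary Z A) A) {v : V}
    (hv : v ∈ G.boundary Z A) : (G.neighborSet v ∩ G.boundary Z A).ncard ≤ 2 := by
  by_contra! hcon
  obtain ⟨a, ha, b, hb, c, hc, hab, hac, hbc⟩ := (Set.two_lt_ncard).1 hcon
  have hu : ∀ i, ![a, b, c] i ∈ G.neighborSet v ∩ G.boundary Z A := by
    intro i
    fin_cases i
    exacts [ha, hb, hc]
  have hinj : Function.Injective ![a, b, c] := by
    intro i j
    fin_cases i <;> fin_cases j <;> simp [hab, hac, hbc, hab.symm, hac.symm, hbc.symm]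
  generalize ![a, b, c] = u at hu hinj
  have hne : ∀ i j, i ≠ j → u j ∈ A \ {v, u i} := fun i j hij =>
    ⟨(hu j).2.1, by
      rintro (h | h)
      · exact (hu j).1.ne h.symm
      · exact hij (hinj h).symm⟩
  have hZd : ∀ w ∈ A, Disjoint Z {w} := fun w hw =>
    Set.disjoint_singleton_right.2 fun h => Set.disjoint_left.1 hZA h hw
  refine hG.false_of_linked (A := Z) (B := {v}) (U := fun i => {u i})
    (W := fun i => A \ {v, u i}) hZ (induce_singleton_connected G v)
    (fun i => induce_singleton_connected G _) (hZd v hv.1) (fun i => hZd _ (hu i).2.1)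
    ?_ ?_ ?_ ?_ ?_ ?_ ?_ ?_ ?_ ?_
  · exact fun i => Set.disjoint_singleton.2 (hu i).1.ne
  · exact fun i j hij => Set.disjoint_singleton.2 (hinj.ne hij)
  · obtain ⟨z, hz, hzv⟩ := hv.2
    exact ⟨z, hz, v, rfl, hzv⟩
  · intro i
    obtain ⟨z, hz, hzv⟩ := (hu i).2.2
    exact ⟨z, hz, u i, rfl, hzv⟩
  · exact fun i => ⟨v, rfl, u i, rfl, (hu i).1⟩
  · exact fun i => hS.connected hv (hu i).2 (hu i).1 ⟨_, hne i (i + 1) (by revert i; decide)⟩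
  · exact fun i => hZA.mono_right Set.sdiff_subset
  · simp
  · simp
  · exact fun i j hij => ⟨u j, hne i j hij, rfl⟩

/-- Without separating chords, some boundary vertex other than `x` and `y` has at most one
neighbour among those boundary vertices. -/
lemma IsPlanar.exists_ncard_neighborSet_le_one (hG : G.IsPlanar) (hZ : (G.induce Z).Connected)
    (hZA : Disjoint Z A) (hS : G.NoSeparatingChord (G.boundary Z A) A) {x y : V}
    (hx : x ∈ G.boundary Z A) (hne : (G.boundary Z A \ {x, y}).Nonempty) :
    ∃ v ∈ G.boundary Z A \ {x, y},
      (G.neighborSet v ∩ (G.boundary Z A \ {x, y})).ncard ≤ 1 := by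
  by_contra! hcon
  obtain ⟨T, hT⟩ : ∃ T, T = G.boundary Z A \ {x, y} := ⟨_, rfl⟩
  rw [← hT] at hne hcon
  have hTS : T ⊆ G.boundary Z A := hT ▸ Set.sdiff_subset
  have hTA : T ⊆ A := fun t ht => (hTS ht).1
  have hNS : ∀ t ∈ T, G.neighborSet t ∩ T = G.neighborSet t ∩ G.boundary Z A := fun t ht =>
    Set.eq_of_subset_of_ncard_le (Set.inter_subset_inter_right _ hTS)
      ((hG.ncard_neighborSet_boundary_le hZ hZA hS (hTS ht)).trans (hcon t ht))
  have hreg : ∀ t ∈ T, (G.neighborSet t ∩ T).ncard = 2 := fun t ht =>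
    le_antisymm (hNS t ht ▸ hG.ncard_neighborSet_boundary_le hZ hZA hS (hTS ht)) (hcon t ht)
  have hxT : x ∉ T := by simp [hT]
  obtain ⟨X, hXA, hxX, hX, hXcl⟩ := exists_connected_closed G (show x ∈ A \ T from ⟨hx.1, hxT⟩)
  by_cases hF : ∃ d ∈ T, G.Touches X {d}
  · obtain ⟨d, hd, hXd⟩ := hF
    obtain ⟨a, b, hab, hN⟩ := Set.ncard_eq_two.1 (hreg d hd)
    have ha : a ∈ G.neighborSet d ∩ T := by simp [hN]
    have hb : b ∈ G.neighborSet d ∩ T := by simp [hN]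
    have had : G.Adj d a := ha.1
    have hbd : G.Adj d b := hb.1
    obtain ⟨C, hCT, haC, hC, hCcl⟩ :=
      exists_connected_closed G (show a ∈ T \ {d} from ⟨ha.2, had.ne'⟩)
    have hbC := mem_of_two_regular hreg hd hN hCT haC hCcl
    have hXT : ∀ w ∈ T, w ∉ X := fun w hw hwX => (hXA hwX).2 hw
    have hZd : ∀ s ⊆ A, Disjoint Z s := fun s hs => hZA.mono_right hs
    have hxd : x ≠ d := fun h => hxT (h ▸ hd)
    have hxa : x ≠ a := fun h => hxT (h ▸ ha.2)
    have hxb : x ≠ b := fun h => hxT (h ▸ hb.2)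
    have ht : ∀ w ∈ G.boundary Z A, ∀ s : Set V, w ∈ s → G.Touches Z s := by
      rintro w ⟨-, z, hz, hzw⟩ s hs
      exact ⟨z, hz, w, hs, hzw⟩
    refine hG.false_of_linked (A := Z) (B := {d}) (U := ![{a}, {b}, X])
      (W := ![A \ {d, a}, A \ {d, b}, C]) hZ (induce_singleton_connected G d)
      ?_ (hZd _ (by simpa using hTA hd)) ?_ ?_ ?_ (ht d (hTS hd) _ rfl) ?_ ?_ ?_ ?_ ?_ ?_ ?_
    · intro i
      fin_cases i
      exacts [induce_singleton_connected G a, induce_singleton_connected G b, hX]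
    · intro i
      fin_cases i
      exacts [hZd _ (by simpa using hTA ha.2), hZd _ (by simpa using hTA hb.2),
        hZd _ fun w hw => (hXA hw).1]
    · intro i
      fin_cases i
      exacts [Set.disjoint_singleton.2 had.ne, Set.disjoint_singleton.2 hbd.ne,
        Set.disjoint_singleton_left.2 (hXT d hd)]
    · have haX : Disjoint {a} X := Set.disjoint_singleton_left.2 (hXT a ha.2)
      have hbX : Disjoint {b} X := Set.disjoint_singleton_left.2 (hXT b hb.2)
      have hab' : Disjoint ({a} : Set V) {b} := Set.disjoint_singleton.2 hab
      intro i j hij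
      fin_cases i <;> fin_cases j <;> first | exact absurd rfl hij | skip
      exacts [hab', haX, hab'.symm, hbX, haX.symm, hbX.symm]
    · intro i
      fin_cases i
      exacts [ht a (hTS ha.2) _ rfl, ht b (hTS hb.2) _ rfl, ht x hx _ hxX]
    · intro i
      fin_cases i
      exacts [⟨d, rfl, a, rfl, had⟩, ⟨d, rfl, b, rfl, hbd⟩, hXd.symm]
    · intro i
      fin_cases i
      exacts [hS.connected (hTS hd) (hTS ha.2) had ⟨x, hx.1, by simp [hxd, hxa]⟩,
        hS.connected (hTS hd) (hTS hb.2) hbd ⟨x, hx.1, by simp [hxd, hxb]⟩, hC]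
    · intro i
      fin_cases i
      exacts [hZd _ Set.sdiff_subset, hZd _ Set.sdiff_subset, hZd _ fun w hw => hTA (hCT hw).1]
    · intro i
      fin_cases i
      exacts [by simp, by simp, Set.disjoint_singleton_left.2 fun h => (hCT h).2 rfl]
    · intro i
      fin_cases i
      exacts [by simp, by simp, Set.disjoint_left.2 fun w hw => hXT w (hCT hw).1]
    · intro i j hij
      fin_cases i <;> fin_cases j <;> first | exact absurd rfl hij | skip
      exacts [⟨b, ⟨hTA hb.2, by simp [hbd.ne', hab.symm]⟩, rfl⟩,
        ⟨x, ⟨hx.1, by simp [hxd, hxa]⟩, hxX⟩,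
        ⟨a, ⟨hTA ha.2, by simp [had.ne', hab]⟩, rfl⟩,
        ⟨x, ⟨hx.1, by simp [hxd, hxb]⟩, hxX⟩, ⟨a, haC, rfl⟩, ⟨b, hbC, rfl⟩]
  · push Not at hF
    obtain ⟨t, ht⟩ := hne
    obtain ⟨a, b, hab, hN⟩ := Set.ncard_eq_two.1 (hreg t ht)
    have ha : a ∈ G.neighborSet t ∩ T := by simp [hN]
    have hb : b ∈ G.neighborSet t ∩ T := by simp [hN]
    have hXeq := hS t (hTS ht) a (hTS ha.2) ha.1 X
      (fun w hw => ⟨(hXA hw).1, by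
        rintro (rfl | rfl)
        exacts [(hXA hw).2 ht, (hXA hw).2 ha.2]⟩) ⟨x, hxX⟩
      (fun u hu w hw huw => hXcl u hu w
        ⟨hw.1, fun hwT => hF w hwT ⟨u, hu, w, rfl, huw⟩⟩ huw)
    have hbX : b ∈ X := by
      rw [hXeq]
      refine ⟨hTA hb.2, ?_⟩
      rintro (h | h)
      exacts [hb.1.ne h.symm, hab h.symm]
    exact (hXA hbX).2 hb.2

end Boundary

section Coloring

variable {α : Type*} {Z A : Set V} {L : V → Finset α}

/-- `φ` is a proper colouring of the subgraph induced on `A`. -/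
def ProperOn (G : SimpleGraph V) (A : Set V) (φ : V → α) : Prop :=
  ∀ u ∈ A, ∀ v ∈ A, G.Adj u v → φ u ≠ φ v

/-- The vertices of `A` have lists of size at least three, and those not on the boundary have
lists of size at least five. -/
def LargeLists (G : SimpleGraph V) (Z A : Set V) (L : V → Finset α) : Prop :=
  ∀ v ∈ A, 3 ≤ (L v).card ∧ (v ∉ G.boundary Z A → 5 ≤ (L v).card)

/-- Thomassen's extension property for `A`: every proper colouring of a boundary vertex, or of an
edge joining two boundary vertices, extends to `A`. -/
def ThomassenExtendable (G : SimpleGraph V) (α : Type*) (A : Set V) : Prop :=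
  ∀ (Z : Set V) (L : V → Finset α) (x y : V) (c : V → α), (G.induce Z).Connected →
    Disjoint Z A → x ∈ G.boundary Z A → y ∈ G.boundary Z A → (x = y ∨ G.Adj x y) →
    (G.Adj x y → c x ≠ c y) →
    (∀ v ∈ A \ {x, y}, 3 ≤ (L v).card ∧ (v ∉ G.boundary Z A → 5 ≤ (L v).card)) →
    ∃ φ : V → α, φ x = c x ∧ φ y = c y ∧ (∀ v ∈ A \ {x, y}, φ v ∈ L v) ∧ G.ProperOn A φ

/-- `A` can be coloured from all lists that are large relative to some connected set. -/
def BoundaryChoosable (G : SimpleGraph V) (α : Type*) (A : Set V) : Prop :=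
  ∀ (Z : Set V) (L : V → Finset α), (G.induce Z).Preconnected → Disjoint Z A →
    G.LargeLists Z A L → ∃ φ : V → α, (∀ v ∈ A, φ v ∈ L v) ∧ G.ProperOn A φ

lemma ProperOn.update [DecidableEq V] {φ : V → α} {v : V} {r : α} (h : G.ProperOn (A \ {v}) φ)
    (hr : ∀ w ∈ A, G.Adj v w → r ≠ φ w) : G.ProperOn A (Function.update φ v r) := by
  intro u hu w hw huw
  by_cases huv : u = v
  · subst huv
    simpa [huw.ne'] using hr w hw huw
  by_cases hwv : w = v
  · subst hwv
    simpa [huw.ne] using (hr u hu huw.symm).symm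
  simpa [huv, hwv] using h u ⟨hu, huv⟩ w ⟨hw, hwv⟩ huw

lemma boundaryChoosable_of_extendable [DecidableEq α] [Nonempty α]
    (ih : ∀ B ⊂ A, G.BoundaryChoosable α B) (hA : G.ThomassenExtendable α A) :
    G.BoundaryChoosable α A := by
  classical
  intro Z L hZ hZA hL
  rcases A.eq_empty_or_nonempty with rfl | ⟨x, hxA⟩
  · exact ⟨fun _ => Classical.arbitrary α, by simp, by simp [ProperOn]⟩
  by_cases hS : (G.boundary Z A).Nonempty
  · obtain ⟨x, hx⟩ := hS
    obtain ⟨a, ha⟩ := Finset.card_pos.1 (by have := (hL x hx.1).1; lia : 0 < (L x).card)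
    obtain ⟨z, hz, -⟩ := hx.2
    obtain ⟨φ, h1, -, h2, h3⟩ := hA Z L x x (fun _ => a)
      { preconnected := hZ, nonempty := ⟨z, hz⟩ } hZA hx hx (Or.inl rfl)
      (fun h => (G.irrefl h).elim) (fun v hv => hL v hv.1)
    refine ⟨φ, fun v hv => ?_, h3⟩
    by_cases hvx : v = x
    · rwa [hvx, h1]
    · exact h2 v ⟨hv, by simpa using hvx⟩
  · rw [Set.not_nonempty_iff_eq_empty] at hS
    have h5 : ∀ v ∈ A, 5 ≤ (L v).card := fun v hv => (hL v hv).2 (by simp [hS])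
    obtain ⟨a, ha⟩ := Finset.card_pos.1 (by have := h5 x hxA; lia : 0 < (L x).card)
    obtain ⟨φ, h1, h2⟩ := ih (A \ {x}) ⟨Set.sdiff_subset, fun h => (h hxA).2 rfl⟩ {x}
      (fun w => if G.Adj x w then (L w).erase a else L w)
      (induce_singleton_connected G x).preconnected (by simp) (by
        intro v hv
        have := h5 v hv.1
        have := Finset.pred_card_le_card_erase (s := L v) (a := a)
        by_cases hxv : G.Adj x v
        · simp only [hxv, if_true]
          exact ⟨by lia, fun h => (h ⟨hv, x, rfl, hxv⟩).elim⟩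
        · simp only [hxv, if_false]
          exact ⟨by lia, fun _ => by lia⟩)
    refine ⟨Function.update φ x a, fun v hv => ?_, h2.update fun w hw hxw => ?_⟩
    · by_cases hvx : v = x
      · simpa [hvx] using ha
      · have := h1 v ⟨hv, hvx⟩
        rw [Function.update_of_ne hvx]
        split_ifs at this
        exacts [Finset.mem_of_mem_erase this, this]
    · have := h1 w ⟨hw, hxw.ne'⟩
      simp only [hxw, if_true] at this
      exact (Finset.ne_of_mem_erase this).symm

/-- Extending along a separation `A = A₁ ∪ A₂` of `G` in an edge `ab` joining boundary vertices. -/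
lemma exists_coloring_of_separation {A₁ A₂ : Set V} {x y a b : V} {c : V → α}
    (h₁ : G.ThomassenExtendable α A₁) (h₂ : G.ThomassenExtendable α A₂)
    (hZ : (G.induce Z).Connected) (hZA : Disjoint Z A) (hA : A = A₁ ∪ A₂)
    (hab : A₁ ∩ A₂ = {a, b}) (hcross : ∀ u ∈ A₁, ∀ w ∈ A₂, G.Adj u w → u ∈ A₂ ∨ w ∈ A₁)
    (ha : a ∈ G.boundary Z A) (hb : b ∈ G.boundary Z A) (hadj : G.Adj a b)
    (hx : x ∈ G.boundary Z A) (hy : y ∈ G.boundary Z A) (hx₁ : x ∈ A₁) (hy₁ : y ∈ A₁)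
    (hxy : x = y ∨ G.Adj x y) (hc : G.Adj x y → c x ≠ c y)
    (hL : ∀ v ∈ A \ {x, y}, 3 ≤ (L v).card ∧ (v ∉ G.boundary Z A → 5 ≤ (L v).card)) :
    ∃ φ : V → α, φ x = c x ∧ φ y = c y ∧ (∀ v ∈ A \ {x, y}, φ v ∈ L v) ∧ G.ProperOn A φ := by
  classical
  have hab₁ : a ∈ A₁ ∩ A₂ ∧ b ∈ A₁ ∩ A₂ := by simp [hab]
  have hA₁ : A₁ ⊆ A := hA ▸ Set.subset_union_left
  have hA₂ : A₂ ⊆ A := hA ▸ Set.subset_union_right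
  obtain ⟨φ₁, hφx, hφy, hφL, hφ⟩ := h₁ Z L x y c hZ (hZA.mono_right hA₁) ⟨hx₁, hx.2⟩ ⟨hy₁, hy.2⟩
    hxy hc fun v hv =>
      ⟨(hL v ⟨hA₁ hv.1, hv.2⟩).1, fun h => (hL v ⟨hA₁ hv.1, hv.2⟩).2 fun h' => h ⟨hv.1, h'.2⟩⟩
  have hnot : ∀ v ∈ A₂ \ {a, b}, v ∉ A₁ := fun v hv hv₁ => hv.2 (hab ▸ ⟨hv₁, hv.1⟩)
  have hxy₂ : ∀ v ∈ A₂ \ {a, b}, v ∈ A \ {x, y} := fun v hv => ⟨hA₂ hv.1, by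
    rintro (rfl | rfl)
    exacts [hnot _ hv hx₁, hnot _ hv hy₁]⟩
  obtain ⟨ψ, hψa, hψb, hψL, hψ⟩ := h₂ Z L a b φ₁ hZ (hZA.mono_right hA₂) ⟨hab₁.1.2, ha.2⟩
    ⟨hab₁.2.2, hb.2⟩ (Or.inr hadj) (hφ a hab₁.1.1 b hab₁.2.1)
    fun v hv => ⟨(hL v (hxy₂ v hv)).1, fun h => (hL v (hxy₂ v hv)).2 fun h' => h ⟨hv.1, h'.2⟩⟩
  have hagree : ∀ v ∈ A₁, v ∈ A₂ → φ₁ v = ψ v := by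
    intro v hv₁ hv₂
    have : v ∈ ({a, b} : Set V) := hab ▸ ⟨hv₁, hv₂⟩
    rcases this with rfl | rfl
    exacts [hψa.symm, hψb.symm]
  refine ⟨fun v => if v ∈ A₁ then φ₁ v else ψ v, by simp [hx₁, hφx], by simp [hy₁, hφy], ?_, ?_⟩
  · intro v hv
    by_cases hv₁ : v ∈ A₁
    · simpa [hv₁] using hφL v ⟨hv₁, hv.2⟩
    · have hv₂ : v ∈ A₂ := (hA ▸ hv.1 : v ∈ A₁ ∪ A₂).resolve_left hv₁
      simpa [hv₁] using hψL v ⟨hv₂, fun h => hv₁ (hab ▸ h : v ∈ A₁ ∩ A₂).1⟩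
  · intro u hu w hw huw
    have hu' : u ∈ A₁ ∪ A₂ := hA ▸ hu
    have hw' : w ∈ A₁ ∪ A₂ := hA ▸ hw
    by_cases hu₁ : u ∈ A₁ <;> by_cases hw₁ : w ∈ A₁ <;> simp only [hu₁, hw₁, if_true, if_false]
    · exact hφ u hu₁ w hw₁ huw
    · have hw₂ := hw'.resolve_left hw₁
      have hu₂ := (hcross u hu₁ w hw₂ huw).resolve_right hw₁
      rw [hagree u hu₁ hu₂]
      exact hψ u hu₂ w hw₂ huw
    · have hu₂ := hu'.resolve_left hu₁
      have hw₂ := (hcross w hw₁ u hu₂ huw.symm).resolve_right hu₁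
      rw [hagree w hw₁ hw₂]
      exact hψ u hu₂ w hw₂ huw
    · exact hψ u (hu'.resolve_left hu₁) w (hw'.resolve_left hw₁) huw

lemma exists_coloring_of_boundary_subset [DecidableEq α] {x y : V} {c : V → α}
    (h : G.BoundaryChoosable α (A \ {x, y})) (hZ : (G.induce Z).Connected) (hZA : Disjoint Z A)
    (hx : x ∈ G.boundary Z A) (hy : y ∈ G.boundary Z A) (hS : G.boundary Z A ⊆ {x, y})
    (hxy : x = y ∨ G.Adj x y) (hc : G.Adj x y → c x ≠ c y)
    (hL : ∀ v ∈ A \ {x, y}, 3 ≤ (L v).card ∧ (v ∉ G.boundary Z A → 5 ≤ (L v).card)) :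
    ∃ φ : V → α, φ x = c x ∧ φ y = c y ∧ (∀ v ∈ A \ {x, y}, φ v ∈ L v) ∧ G.ProperOn A φ := by
  classical
  have h5 : ∀ v ∈ A \ {x, y}, 5 ≤ (L v).card := fun v hv => (hL v hv).2 fun h => hv.2 (hS h)
  obtain ⟨z₁, hz₁, hzx⟩ := hx.2
  obtain ⟨z₂, hz₂, hzy⟩ := hy.2
  have hZ' : (G.induce (insert y (insert x Z))).Connected :=
    induce_insert_connected (induce_insert_connected hZ hz₁ hzx) (Set.mem_insert_of_mem _ hz₂) hzy
  obtain ⟨φ, hφL, hφ⟩ := h (insert y (insert x Z))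
    (fun w => if G.Adj x w ∨ G.Adj y w then L w \ {c x, c y} else L w) hZ'.preconnected (by
      rw [Set.disjoint_insert_left, Set.disjoint_insert_left]
      exact ⟨by simp, by simp, hZA.mono_right Set.sdiff_subset⟩) (by
      intro v hv
      have h1 := h5 v hv
      have h2 := Finset.le_card_sdiff {c x, c y} (L v)
      have h3 := Finset.card_le_two (a := c x) (b := c y)
      dsimp only
      split_ifs with hadj
      · refine ⟨by lia, fun h => (h ⟨hv, ?_⟩).elim⟩
        rcases hadj with hadj | hadj
        exacts [⟨x, by simp, hadj⟩, ⟨y, by simp, hadj⟩]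
      · exact ⟨by lia, fun _ => h1⟩)
  have hφL' : ∀ v ∈ A \ {x, y}, φ v ∈ L v := by
    intro v hv
    have := hφL v hv
    split_ifs at this
    exacts [(Finset.mem_sdiff.1 this).1, this]
  have hφx : ∀ v ∈ A \ {x, y}, G.Adj x v ∨ G.Adj y v → φ v ≠ c x ∧ φ v ≠ c y := by
    intro v hv hadj
    have := hφL v hv
    rw [if_pos hadj] at this
    simpa using (Finset.mem_sdiff.1 this).2
  obtain ⟨ψ, hψ, hψ'⟩ : ∃ ψ : V → α, (∀ v ∈ ({x, y} : Set V), ψ v = c v) ∧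
      ∀ v ∉ ({x, y} : Set V), ψ v = φ v :=
    ⟨fun v => if v ∈ ({x, y} : Set V) then c v else φ v, fun v hv => if_pos hv,
      fun v hv => if_neg hv⟩
  refine ⟨ψ, hψ x (by simp), hψ y (by simp), fun v hv => hψ' v hv.2 ▸ hφL' v hv, ?_⟩
  intro u hu w hw huw
  by_cases hu' : u ∈ ({x, y} : Set V) <;> by_cases hw' : w ∈ ({x, y} : Set V)
  · rw [hψ u hu', hψ w hw']
    rcases hu' with rfl | rfl <;> rcases hw' with rfl | rfl
    exacts [(G.irrefl huw).elim, hc huw, (hc huw.symm).symm, (G.irrefl huw).elim]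
  · rw [hψ u hu', hψ' w hw']
    rcases hu' with rfl | rfl
    exacts [(hφx w ⟨hw, hw'⟩ (Or.inl huw)).1.symm, (hφx w ⟨hw, hw'⟩ (Or.inr huw)).2.symm]
  · rw [hψ w hw', hψ' u hu']
    rcases hw' with rfl | rfl
    exacts [(hφx u ⟨hu, hu'⟩ (Or.inl huw.symm)).1, (hφx u ⟨hu, hu'⟩ (Or.inr huw.symm)).2]
  · rw [hψ' u hu', hψ' w hw']
    exact hφ u ⟨hu, hu'⟩ w ⟨hw, hw'⟩ huw

/-- Extending to a boundary vertex `v` with few boundary neighbours: colours reserved for `v` are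
withheld from its interior neighbours. -/
lemma exists_coloring_of_few_boundary_neighbors [Finite V] [DecidableEq α] {x y v : V} {c : V → α}
    (h : G.ThomassenExtendable α (A \ {v})) (hZ : (G.induce Z).Connected) (hZA : Disjoint Z A)
    (hx : x ∈ G.boundary Z A) (hy : y ∈ G.boundary Z A) (hv : v ∈ G.boundary Z A \ {x, y})
    (hv₁ : (G.neighborSet v ∩ (G.boundary Z A \ {x, y})).ncard ≤ 1)
    (hv₂ : (G.neighborSet v ∩ G.boundary Z A).ncard ≤ 2)
    (hxy : x = y ∨ G.Adj x y) (hc : G.Adj x y → c x ≠ c y)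
    (hL : ∀ v ∈ A \ {x, y}, 3 ≤ (L v).card ∧ (v ∉ G.boundary Z A → 5 ≤ (L v).card)) :
    ∃ φ : V → α, φ x = c x ∧ φ y = c y ∧ (∀ v ∈ A \ {x, y}, φ v ∈ L v) ∧ G.ProperOn A φ := by
  classical
  have := Fintype.ofFinite V
  have hvx : x ≠ v := fun h => hv.2 (Or.inl h.symm)
  have hvy : y ≠ v := fun h => hv.2 (Or.inr h.symm)
  obtain ⟨P, hP⟩ : ∃ P : Finset V, (P : Set V) = G.neighborSet v ∩ {x, y} :=
    ⟨(G.neighborSet v ∩ {x, y}).toFinset, by simp⟩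
  obtain ⟨Q, hQ⟩ : ∃ Q : Finset V, (Q : Set V) = G.neighborSet v ∩ (G.boundary Z A \ {x, y}) :=
    ⟨(G.neighborSet v ∩ (G.boundary Z A \ {x, y})).toFinset, by simp⟩
  have hPQ : P.card + Q.card ≤ 2 := by
    rw [← Finset.card_union_of_disjoint, ← Set.ncard_coe_finset, Finset.coe_union, hP, hQ]
    · refine (Set.ncard_le_ncard ?_).trans hv₂
      rintro w (⟨h1, rfl | rfl⟩ | h)
      exacts [⟨h1, hx⟩, ⟨h1, hy⟩, ⟨h.1, h.2.1⟩]
    · rw [← Finset.disjoint_coe, hP, hQ, Set.disjoint_left]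
      exact fun w h1 h2 => h2.2.2 h1.2
  have hQ₁ : Q.card ≤ 1 := by rwa [← Set.ncard_coe_finset, hQ]
  obtain ⟨R, hR, hRcard⟩ := Finset.exists_subset_card_eq
    (s := L v \ P.image c) (n := Q.card + 1) (by
    have h1 := (hL v ⟨hv.1.1, hv.2⟩).1
    have h2 := Finset.le_card_sdiff (P.image c) (L v)
    have h3 := Finset.card_image_le (s := P) (f := c)
    lia)
  obtain ⟨z, hz, hzv⟩ := hv.1.2
  have hmem : ∀ w ∈ G.boundary Z A, w ≠ v → w ∈ G.boundary (insert v Z) (A \ {v}) := by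
    rintro w ⟨hw, z', hz', hzw⟩ hwv
    exact ⟨⟨hw, hwv⟩, z', Set.mem_insert_of_mem _ hz', hzw⟩
  obtain ⟨φ, hφx, hφy, hφL, hφ⟩ := h (insert v Z)
    (fun w => if G.Adj v w ∧ w ∉ G.boundary Z A then L w \ R else L w) x y c
    (induce_insert_connected hZ hz hzv)
    (by
      rw [Set.disjoint_insert_left]
      exact ⟨by simp, hZA.mono_right Set.sdiff_subset⟩)
    (hmem x hx hvx) (hmem y hy hvy) hxy hc (by
      intro w hw
      have hLw := hL w ⟨hw.1.1, hw.2⟩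
      split_ifs with hcond
      · have h1 := hLw.2 hcond.2
        have h2 := Finset.le_card_sdiff R (L w)
        exact ⟨by lia, fun h => (h ⟨hw.1, v, Set.mem_insert _ _, hcond.1⟩).elim⟩
      · exact ⟨hLw.1, fun h => hLw.2 fun h' => h (hmem w h' hw.1.2)⟩)
  obtain ⟨r, hrR, hrQ⟩ := Finset.exists_mem_notMem_of_card_lt_card
    (s := Q.image φ) (t := R) (by have := Finset.card_image_le (s := Q) (f := φ); lia)
  have hr := Finset.mem_sdiff.1 (hR hrR)
  refine ⟨Function.update φ v r, by rwa [Function.update_of_ne hvx],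
    by rwa [Function.update_of_ne hvy], fun w hw => ?_, hφ.update fun w hw hvw => ?_⟩
  · by_cases hwv : w = v
    · subst hwv
      simpa using hr.1
    · rw [Function.update_of_ne hwv]
      have := hφL w ⟨⟨hw.1, hwv⟩, hw.2⟩
      split_ifs at this
      exacts [(Finset.mem_sdiff.1 this).1, this]
  · by_cases hwxy : w ∈ ({x, y} : Set V)
    · have hwP : w ∈ P := by
        rw [← Finset.mem_coe, hP]
        exact ⟨hvw, hwxy⟩
      have : φ w = c w := by
        rcases hwxy with rfl | rfl
        exacts [hφx, hφy]
      rw [this]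
      rintro rfl
      exact hr.2 (Finset.mem_image_of_mem c hwP)
    · by_cases hwS : w ∈ G.boundary Z A
      · have hwQ : w ∈ Q := by
          rw [← Finset.mem_coe, hQ]
          exact ⟨hvw, hwS, hwxy⟩
        rintro rfl
        exact hrQ (Finset.mem_image_of_mem φ hwQ)
      · have := hφL w ⟨⟨hw, hvw.ne'⟩, hwxy⟩
        rw [if_pos ⟨hvw, hwS⟩] at this
        rintro rfl
        exact (Finset.mem_sdiff.1 this).2 hrR

lemma IsPlanar.thomassenExtendable_of_ssubset [Finite V] [DecidableEq α] (hG : G.IsPlanar)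
    (ih : ∀ B ⊂ A, G.ThomassenExtendable α B) (ih' : ∀ B ⊂ A, G.BoundaryChoosable α B) :
    G.ThomassenExtendable α A := by
  intro Z L x y c hZ hZA hx hy hxy hc hL
  by_cases hS : G.NoSeparatingChord (G.boundary Z A) A
  · rcases (G.boundary Z A \ {x, y}).eq_empty_or_nonempty with hT | hT
    · exact exists_coloring_of_boundary_subset
        (ih' _ ⟨Set.sdiff_subset, fun h => (h hx.1).2 (Or.inl rfl)⟩) hZ hZA hx hy
        (Set.sdiff_eq_empty.1 hT) hxy hc hL
    · obtain ⟨v, hv, hv₁⟩ := hG.exists_ncard_neighborSet_le_one hZ hZA hS hx hT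
      exact exists_coloring_of_few_boundary_neighbors
        (ih _ ⟨Set.sdiff_subset, fun h => (h hv.1.1).2 rfl⟩) hZ hZA hx hy hv hv₁
        (hG.ncard_neighborSet_boundary_le hZ hZA hS hv.1) hxy hc hL
  · simp only [NoSeparatingChord, not_forall] at hS
    obtain ⟨a, ha, b, hb, hab, B, hBA, ⟨u, hu⟩, hB, hne⟩ := hS
    obtain ⟨w, hw, hwB⟩ := Set.exists_of_ssubset (hBA.ssubset_of_ne hne)
    have hsub : B ∪ {a, b} ⊆ A := Set.union_subset (fun t ht => (hBA ht).1) (by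
      rintro t (rfl | rfl)
      exacts [ha.1, hb.1])
    have h₁ := ih (B ∪ {a, b}) ⟨hsub, fun h => (h hw.1).elim hwB hw.2⟩
    have h₂ := ih (A \ B) ⟨Set.sdiff_subset, fun h => (h (hBA hu).1).2 hu⟩
    have haB : a ∉ B := fun h => (hBA h).2 (Or.inl rfl)
    have hbB : b ∉ B := fun h => (hBA h).2 (Or.inr rfl)
    have hcross : ∀ u ∈ B ∪ {a, b}, ∀ w ∈ A \ B, G.Adj u w → u ∈ A \ B ∨ w ∈ B ∪ {a, b} := by
      intro u hu w hw huw
      by_cases hwab : w ∈ ({a, b} : Set V)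
      · exact Or.inr (Or.inr hwab)
      rcases hu with hu | hu
      · exact (hw.2 (hB u hu w ⟨hw.1, hwab⟩ huw)).elim
      · refine Or.inl ⟨hsub (Or.inr hu), ?_⟩
        rcases hu with rfl | rfl
        exacts [haB, hbB]
    have hinter : (B ∪ {a, b}) ∩ (A \ B) = {a, b} := by
      ext t
      constructor
      · exact fun h => h.1.resolve_left h.2.2
      · intro h
        refine ⟨Or.inr h, hsub (Or.inr h), ?_⟩
        rcases h with rfl | rfl
        exacts [haB, hbB]
    have hunion : A = (B ∪ {a, b}) ∪ (A \ B) := by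
      ext t
      constructor
      · intro h
        by_cases ht : t ∈ B
        exacts [Or.inl (Or.inl ht), Or.inr ⟨h, ht⟩]
      · rintro (h | h)
        exacts [hsub h, h.1]
    have hside : (x ∈ B ∪ {a, b} ∧ y ∈ B ∪ {a, b}) ∨ (x ∈ A \ B ∧ y ∈ A \ B) := by
      have hx' : x ∈ (B ∪ {a, b}) ∪ (A \ B) := hunion ▸ hx.1
      have hy' : y ∈ (B ∪ {a, b}) ∪ (A \ B) := hunion ▸ hy.1
      rcases hxy with rfl | hxy
      · exact hx'.imp (fun h => ⟨h, h⟩) fun h => ⟨h, h⟩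
      · rcases hx' with hx' | hx' <;> rcases hy' with hy' | hy'
        · exact Or.inl ⟨hx', hy'⟩
        · exact (hcross x hx' y hy' hxy).symm.imp (fun h => ⟨hx', h⟩) fun h => ⟨h, hy'⟩
        · exact (hcross y hy' x hx' hxy.symm).symm.imp (fun h => ⟨h, hy'⟩) fun h => ⟨hx', h⟩
        · exact Or.inr ⟨hx', hy'⟩
    rcases hside with ⟨hx', hy'⟩ | ⟨hx', hy'⟩
    · exact exists_coloring_of_separation h₁ h₂ hZ hZA hunion hinter hcross ha hb hab hx hy hx' hy'
        hxy hc hL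
    · exact exists_coloring_of_separation h₂ h₁ hZ hZA (by rwa [Set.union_comm])
        (by rwa [Set.inter_comm]) (fun u hu w hw huw => (hcross w hw u hu huw.symm).symm)
        ha hb hab hx hy hx' hy' hxy hc hL

lemma IsPlanar.thomassenExtendable_and_boundaryChoosable [Finite V] [DecidableEq α] [Nonempty α]
    (hG : G.IsPlanar) (A : Set V) : G.ThomassenExtendable α A ∧ G.BoundaryChoosable α A := by
  induction A using WellFoundedLT.induction with
  | ind A ih =>
    have h := hG.thomassenExtendable_of_ssubset (fun B hB => (ih B hB).1) fun B hB => (ih B hB).2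
    exact ⟨h, boundaryChoosable_of_extendable (fun B hB => (ih B hB).2) h⟩

end Coloring

end SimpleGraph

/-- Thomassen's theorem: every finite planar graph is 5-choosable. -/
theorem planar_five_choosable {V : Type*} [Fintype V] {α : Type*} [DecidableEq α]
    (G : SimpleGraph V) (hG : G.IsPlanar) (L : V → Finset α)
    (hL : ∀ v, 5 ≤ (L v).card) :
    ∃ φ : V → α, (∀ v, φ v ∈ L v) ∧ ∀ ⦃u v⦄, G.Adj u v → φ u ≠ φ v := by
  rcases isEmpty_or_nonempty V with hV | ⟨⟨v⟩⟩
  · exact ⟨isEmptyElim, isEmptyElim, fun u => isEmptyElim u⟩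
  have hpos : 0 < (L v).card := by have := hL v; lia
  have : Nonempty α := (Finset.card_pos.1 hpos).elim fun a _ => ⟨a⟩
  obtain ⟨φ, hφL, hφ⟩ := (hG.thomassenExtendable_and_boundaryChoosable (α := α) Set.univ).2 ∅ L
    SimpleGraph.Preconnected.of_subsingleton (Set.empty_disjoint _)
    fun v _ => ⟨(hL v).trans' (by decide), fun _ => hL v⟩
  exact ⟨φ, fun v => hφL v trivial, fun u v => hφ u trivial v trivial⟩
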